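/- arXiv:2407.06338 — 2 statements merged into one kernel-verified Lean document; each statement's English description precedes it below -/
import Mathlib

section
/- For all n ≥ 3, the number of cyclic permutations π ∈ S_n such that both π and θ(π) avoid the pattern 213 is equal to 2·F_n − 2. -/
/-- The one-line word of the image of `π` under the fundamental bijection:
write `π` in standard cycle form (every cycle written with its largest element
first, cycles listed in increasing order of their largest elements) and erase
the parentheses.  The cycle maxima are exactly the `x` with `π^[k] x ≤ x` for
all `k`, and the cycle of `x` is `x, π x, π² x, …` up to the period of `x`. -/
noncomputable def fundWord {n : ℕ} (π : Equiv.Perm (Fin n)) : List (Fin n) :=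
  ((List.finRange n).filter fun x => (List.range n).all fun k => decide ((⇑π)^[k] x ≤ x)).flatMap
    fun x => (List.range (Function.minimalPeriod (⇑π) x)).map fun k => (⇑π)^[k] x

/-- The permutation whose one-line notation is the word `w`
(junk value if `w` is not the one-line notation of a permutation). -/
noncomputable def permOfWord {n : ℕ} (w : List (Fin n)) : Equiv.Perm (Fin n) :=
  Function.invFun (fun σ : Equiv.Perm (Fin n) => (List.finRange n).map ⇑σ) w

/-- The fundamental bijection `θ`. -/
noncomputable def theta {n : ℕ} (π : Equiv.Perm (Fin n)) : Equiv.Perm (Fin n) :=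
  permOfWord (fundWord π)

/-- `π` contains the pattern `σ`. -/
def Contains {k n : ℕ} (σ : Equiv.Perm (Fin k)) (π : Equiv.Perm (Fin n)) : Prop :=
  ∃ f : Fin k → Fin n, StrictMono f ∧ ∀ a b : Fin k, π (f a) < π (f b) ↔ σ a < σ b

/-- `π` avoids the pattern `σ`. -/
def Avoids {k n : ℕ} (π : Equiv.Perm (Fin n)) (σ : Equiv.Perm (Fin k)) : Prop :=
  ¬ Contains σ π

noncomputable def p123 : Equiv.Perm (Fin 3) := Equiv.ofBijective ![0, 1, 2] (by decide)
noncomputable def p132 : Equiv.Perm (Fin 3) := Equiv.ofBijective ![0, 2, 1] (by decide)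
noncomputable def p213 : Equiv.Perm (Fin 3) := Equiv.ofBijective ![1, 0, 2] (by decide)
noncomputable def p231 : Equiv.Perm (Fin 3) := Equiv.ofBijective ![1, 2, 0] (by decide)
noncomputable def p312 : Equiv.Perm (Fin 3) := Equiv.ofBijective ![2, 0, 1] (by decide)
noncomputable def p321 : Equiv.Perm (Fin 3) := Equiv.ofBijective ![2, 1, 0] (by decide)

/-- The direct sum `π ⊕ τ` of two permutations. -/
def directSum {n m : ℕ} (π : Equiv.Perm (Fin n)) (τ : Equiv.Perm (Fin m)) :
    Equiv.Perm (Fin (n + m)) :=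
  finSumFinEquiv.permCongr (Equiv.sumCongr π τ)

/-- A permutation is irreducible if it is not a direct sum of two nonempty permutations. -/
def IrreduciblePerm {n : ℕ} (π : Equiv.Perm (Fin n)) : Prop :=
  ¬ ∃ (a b : ℕ) (_ : 0 < a) (_ : 0 < b) (h : a + b = n)
      (σ : Equiv.Perm (Fin a)) (τ : Equiv.Perm (Fin b)),
      π = (finCongr h).permCongr (directSum σ τ)

/-- A permutation is cyclic if its cycle decomposition is a single cycle of full length,
i.e. it acts transitively. -/
def IsCyclicPerm {n : ℕ} (π : Equiv.Perm (Fin n)) : Prop :=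
  ∀ x y : Fin n, ∃ k : ℕ, (⇑π)^[k] x = y

/-- `Step l a b` says that `b` immediately follows `a` somewhere in the list `l`. -/
def Step : List ℕ → ℕ → ℕ → Prop
  | x :: y :: l, a, b => (a = x ∧ b = y) ∨ Step (y :: l) a b
  | _, _, _ => False

/-- The (partial) map with graph `R` has no `213` pattern in its one-line notation. -/
def GraphAvoids (R : ℕ → ℕ → Prop) : Prop :=
  ∀ a b c x y z, R a x → R b y → R c z → a < b → b < c → ¬ (y < x ∧ x < z)

/-- The word `l` has no `213` pattern. -/
def WordAvoids (l : List ℕ) : Prop :=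
  l.Triplewise fun x y z => ¬ (y < x ∧ x < z)

@[simp] theorem step_nil (a b : ℕ) : ¬ Step [] a b := by simp [Step]

@[simp] theorem step_singleton (x a b : ℕ) : ¬ Step [x] a b := by simp [Step]

@[simp] theorem step_cons_cons (x y : ℕ) (l : List ℕ) (a b : ℕ) :
    Step (x :: y :: l) a b ↔ (a = x ∧ b = y) ∨ Step (y :: l) a b := by simp [Step]

theorem step_append_cons (l : List ℕ) (x : ℕ) (m : List ℕ) (a b : ℕ) :
    Step (l ++ x :: m) a b ↔ Step (l ++ [x]) a b ∨ Step (x :: m) a b := by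
  induction l with
  | nil => simp
  | cons y l ih =>
    cases l with
    | nil => simp
    | cons z l => simp only [List.cons_append, step_cons_cons] at ih ⊢; rw [ih, or_assoc]

theorem step_append_pair (l : List ℕ) (x y a b : ℕ) :
    Step (l ++ [x, y]) a b ↔ Step (l ++ [x]) a b ∨ (a = x ∧ b = y) := by
  rw [step_append_cons]; simp

theorem Step.mem_of_append_singleton {l : List ℕ} {z a b : ℕ} (h : Step (l ++ [z]) a b) :
    a ∈ l := by
  induction l with
  | nil => simp at h
  | cons x l ih =>
    cases l with
    | nil => simp at h; simp [h.1]
    | cons y l =>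
      simp only [List.cons_append, step_cons_cons] at h ih
      rcases h with h | h
      · simp [h.1]
      · exact List.mem_cons_of_mem _ (ih h)

theorem Step.mem_of_cons {l : List ℕ} {z a b : ℕ} (h : Step (z :: l) a b) : b ∈ l := by
  induction l generalizing z with
  | nil => simp at h
  | cons x l ih =>
    rcases (step_cons_cons ..).1 h with h | h
    · simp [h.2]
    · exact List.mem_cons_of_mem _ (ih h)

theorem wordAvoids_cons {x : ℕ} {l : List ℕ} :
    WordAvoids (x :: l) ↔ l.Pairwise (fun y z => ¬ (y < x ∧ x < z)) ∧ WordAvoids l := by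
  simp [WordAvoids, List.triplewise_cons, and_comm]

theorem wordAvoids_cons_of_forall {x : ℕ} {l : List ℕ}
    (h : (∀ y ∈ l, x ≤ y) ∨ ∀ y ∈ l, y ≤ x) : WordAvoids (x :: l) ↔ WordAvoids l := by
  rw [wordAvoids_cons, and_iff_right]
  exact List.pairwise_of_forall_mem_list fun y hy z hz => by grind

theorem wordAvoids_concat_of_forall {x : ℕ} {l : List ℕ}
    (h : ∀ y ∈ l, x ≤ y) : WordAvoids (l ++ [x]) ↔ WordAvoids l := by
  unfold WordAvoids
  rw [List.triplewise_append]
  simp only [List.triplewise_singleton, List.pairwise_singleton, implies_true, true_and,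
    List.mem_singleton, forall_eq, and_iff_left_iff_imp]
  exact fun _ => List.pairwise_of_forall_mem_list fun y hy z hz => by grind

theorem WordAvoids.not_lt_of_append_cons {u v : List ℕ} {x y z : ℕ}
    (h : WordAvoids (u ++ x :: v)) (hy : y ∈ u) (hz : z ∈ v) : ¬ (x < y ∧ y < z) := by
  exact (List.pairwise_cons.1 ((List.triplewise_append.1 h).2.2.1 y hy)).1 z hz

theorem exists_step_append_cons {u : List ℕ} (hu : u ≠ []) (x : ℕ) (v : List ℕ) :
    ∃ y ∈ u, Step (u ++ x :: v) y x := by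
  obtain ⟨w, y, rfl⟩ := (List.eq_nil_or_concat' u).resolve_left hu
  refine ⟨y, by simp, ?_⟩
  rw [List.append_assoc, List.singleton_append, step_append_cons]
  simp

/-- A `213`-avoiding word that is entered from a position below its letters and leaves to a value
below its letters starts with its largest letter or is increasing. -/
theorem head_eq_or_pairwise_lt {R : ℕ → ℕ → Prop} (hR : GraphAvoids R) {v M a b : ℕ}
    {V : List ℕ} (hw : WordAvoids (v :: V)) (hd : (v :: V).Nodup) (hM : M ∈ v :: V)
    (hle : ∀ x ∈ v :: V, x ≤ M) (ha : ∀ x ∈ v :: V, a < x) (hb : ∀ x ∈ v :: V, b < x)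
    (hs : ∀ x y, Step (a :: v :: V ++ [b]) x y → R x y) :
    v = M ∨ (v :: V).Pairwise (· < ·) := by
  refine or_iff_not_imp_left.2 fun hv => ?_
  obtain ⟨s, t, rfl⟩ := List.append_of_mem ((List.mem_cons.1 hM).resolve_left (Ne.symm hv))
  rw [← List.cons_append] at *
  obtain ⟨-, -, h1, h2⟩ := List.triplewise_append.1 hw
  obtain ⟨hd1, hd2, hd3⟩ := List.nodup_append.1 hd
  have hasc : (v :: s).Pairwise (· < ·) := by
    refine ((h2 M (by simp)).and hd1).imp_of_mem ?_
    intro x y hx hy hxy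
    have := hle x (List.mem_append.2 (.inl hx))
    have := hle y (List.mem_append.2 (.inl hy))
    have := hd3 x hx M (by simp)
    have := hd3 y hy M (by simp)
    have := hxy.2
    omega
  cases t with
  | nil =>
    refine List.pairwise_append.2 ⟨hasc, by simp, fun x hx y hy => ?_⟩
    obtain rfl := List.mem_singleton.1 hy
    exact lt_of_le_of_ne (hle x (List.mem_append.2 (.inl hx))) (hd3 x hx y (by simp))
  | cons w t =>
    exfalso
    obtain ⟨u, hu, hstep⟩ := exists_step_append_cons (u := v :: s) (by simp) M ((w :: t) ++ [b])
    obtain ⟨l, hl, hstep'⟩ := exists_step_append_cons (u := w :: t) (by simp) b []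
    rw [show a :: (v :: s ++ M :: w :: t) ++ [b] = a :: (v :: s ++ M :: (w :: t ++ [b])) by simp]
      at hs
    have hav : R a v := hs _ _ (by simp)
    have huM : R u M := hs _ _ ((step_cons_cons ..).2 (.inr hstep))
    have htail x y (h : Step (M :: (w :: t ++ [b])) x y) : R x y :=
      hs _ _ ((step_append_cons (a :: v :: s) ..).2 (.inr h))
    have hMw : R M w := htail _ _ (by simp)
    have hlb : R l b := htail _ _ ((step_cons_cons ..).2 (.inr hstep'))
    have hl' : l ∈ v :: s ++ M :: w :: t :=
      List.mem_append.2 (.inr (List.mem_cons_of_mem _ hl))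
    have e1 := hR _ _ _ _ _ _ hav hlb hMw
    have e2 := hR _ _ _ _ _ _ hav hlb huM
    have e3 : v ≤ u := by
      rcases List.mem_cons.1 hu with rfl | hu
      · exact le_rfl
      · exact (List.rel_of_pairwise_cons hasc hu).le
    have e4 : w = l ∨ ¬ (w < v ∧ v < l) := by
      rcases List.mem_cons.1 hl with rfl | hl
      · exact .inl rfl
      · have := (List.pairwise_cons.1 (h1 v (by simp))).2
        exact .inr (List.rel_of_pairwise_cons this hl)
    have e5 := hd3 u hu l (List.mem_cons_of_mem _ hl)
    have e6 := hd3 v (by simp) w (by simp)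
    have e7 : M ≠ l := fun h => (List.nodup_cons.1 hd2).1 (h ▸ hl)
    have e8 := hle l hl'
    have e9 := ha l hl'
    have e10 := hb v (by simp)
    have e11 := hle u (List.mem_append.2 (.inl hu))
    have e12 := hd3 u hu M (by simp)
    omega

/-- The words `V` on the letters strictly between `lo` and `lo + k + 1`. -/
def Fills (lo k : ℕ) (V : List ℕ) : Prop :=
  V ≠ [] ∧ V.Nodup ∧ ∀ x, x ∈ V ↔ lo < x ∧ x ≤ lo + k

/-- The nonempty words `V` such that the cycle `(lo + k + 1, V, lo)` and its one-line
notation avoid `213`. -/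
def minLast (lo k : ℕ) : Set (List ℕ) :=
  {V | Fills lo k V ∧ WordAvoids V ∧ GraphAvoids (Step ((lo + k + 1) :: V ++ [lo, lo + k + 1]))}

/-- The nonempty words `V` such that the cycle `(lo + k + 1, lo, V)` and its one-line
notation avoid `213`. -/
def minSecond (lo k : ℕ) : Set (List ℕ) :=
  {V | Fills lo k V ∧ WordAvoids V ∧ GraphAvoids (Step ((lo + k + 1) :: lo :: V ++ [lo + k + 1]))}

theorem Fills.eq_range' {lo k : ℕ} {V : List ℕ} (h : Fills lo k V) (hs : V.Pairwise (· < ·)) :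
    V = List.range' (lo + 1) k := by
  refine List.Perm.eq_of_pairwise' hs List.pairwise_lt_range' ?_
  rw [List.perm_ext_iff_of_nodup h.2.1 List.nodup_range']
  intro x
  rw [h.2.2, List.mem_range'_1]
  omega

theorem fills_range' (lo k : ℕ) : Fills lo (k + 1) (List.range' (lo + 1) (k + 1)) := by
  refine ⟨by simp, List.nodup_range', fun x => ?_⟩
  rw [List.mem_range'_1]
  omega

theorem fills_cons_iff {lo k : ℕ} {V : List ℕ} (hV : V ≠ []) :
    Fills lo (k + 1) ((lo + 1) :: V) ↔ Fills (lo + 1) k V := by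
  unfold Fills
  simp only [ne_eq, hV, reduceCtorEq, not_false_eq_true, List.nodup_cons, List.mem_cons, true_and]
  constructor
  · rintro ⟨⟨h1, h2⟩, h3⟩
    refine ⟨h2, fun x => ?_⟩
    have := h3 x
    by_cases hx : x = lo + 1
    · subst hx; simp [h1]
    · grind
  · rintro ⟨h2, h3⟩
    have := h3 (lo + 1)
    grind

theorem fills_perm_iff {lo k : ℕ} {V W : List ℕ} (h : V.Perm W) : Fills lo k V ↔ Fills lo k W := by
  have hnil : V = [] ↔ W = [] := by
    constructor <;> rintro rfl
    · exact h.symm.eq_nil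
    · exact h.eq_nil
  simp only [Fills, ne_eq, hnil, h.nodup_iff, h.mem_iff]

theorem fills_concat_iff {lo k : ℕ} {V : List ℕ} (hV : V ≠ []) :
    Fills lo (k + 1) (V ++ [lo + 1]) ↔ Fills (lo + 1) k V :=
  (fills_perm_iff (List.perm_append_singleton _ _)).trans (fills_cons_iff hV)

theorem fills_cons_max_iff {lo k : ℕ} {V : List ℕ} (hV : V ≠ []) :
    Fills lo (k + 1) ((lo + k + 1) :: V) ↔ Fills lo k V := by
  unfold Fills
  simp only [ne_eq, hV, reduceCtorEq, not_false_eq_true, List.nodup_cons, List.mem_cons, true_and]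
  constructor
  · rintro ⟨⟨h1, h2⟩, h3⟩
    refine ⟨h2, fun x => ?_⟩
    have := h3 x
    by_cases hx : x = lo + k + 1
    · subst hx; simp [h1]
    · grind
  · rintro ⟨h2, h3⟩
    have := h3 (lo + k + 1)
    grind

theorem concat_mem_minLast_iff {lo k : ℕ} {V : List ℕ} (hV : V ≠ []) :
    V ++ [lo + 1] ∈ minLast lo (k + 1) ↔ V ∈ minLast (lo + 1) k := by
  unfold minLast
  simp only [Set.mem_ofPred_eq, fills_concat_iff hV]
  refine and_congr_right fun hf => ?_
  rw [wordAvoids_concat_of_forall fun y hy => ((hf.2.2 y).1 hy).1.le]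
  refine and_congr_right fun _ => ?_
  have hle a b (h : Step ((lo + k + 2) :: V ++ [lo + 1]) a b) :
      lo + 2 ≤ a ∧ a ≤ lo + k + 2 ∧ lo + 1 ≤ b ∧ b < lo + k + 2 := by
    have h1 := h.mem_of_append_singleton
    have h2 : b ∈ V ++ [lo + 1] := h.mem_of_cons
    have := hf.2.2 a
    have := hf.2.2 b
    grind
  have e1 a b : Step ((lo + (k + 1) + 1) :: (V ++ [lo + 1]) ++ [lo, lo + (k + 1) + 1]) a b ↔
      Step ((lo + k + 2) :: V ++ [lo + 1]) a b ∨ (a = lo + 1 ∧ b = lo) ∨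
        (a = lo ∧ b = lo + k + 2) := by
    rw [show (lo + (k + 1) + 1) :: (V ++ [lo + 1]) ++ [lo, lo + (k + 1) + 1] =
      ((lo + k + 2) :: V) ++ (lo + 1) :: [lo, lo + k + 2] by simp [add_assoc], step_append_cons]
    simp
  have e2 a b : Step ((lo + 1 + k + 1) :: V ++ [lo + 1, lo + 1 + k + 1]) a b ↔
      Step ((lo + k + 2) :: V ++ [lo + 1]) a b ∨ (a = lo + 1 ∧ b = lo + k + 2) := by
    rw [step_append_cons, show lo + 1 + k + 1 = lo + k + 2 by ring]
    simp
  simp only [GraphAvoids, e1, e2]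
  generalize Step ((lo + k + 2) :: V ++ [lo + 1]) = P at hle
  clear e1 e2 hf hV
  constructor <;> intro h a b c x y z ha hb hc hab hbc
    <;> have := hle a x <;> have := hle b y <;> have := hle c z <;> clear hle
  · have h1 := h a b c x y z
    clear h
    grind
  · have h1 := h a b c x y z
    clear h
    grind

theorem cons_mem_minSecond_iff {lo k : ℕ} {V : List ℕ} (hV : V ≠ []) :
    (lo + 1) :: V ∈ minSecond lo (k + 1) ↔ V ∈ minSecond (lo + 1) k := by
  unfold minSecond
  simp only [Set.mem_ofPred_eq, fills_cons_iff hV]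
  refine and_congr_right fun hf => ?_
  rw [wordAvoids_cons_of_forall (.inl fun y hy => ((hf.2.2 y).1 hy).1.le)]
  refine and_congr_right fun _ => ?_
  have hle a b (h : Step ((lo + 1) :: V ++ [lo + k + 2]) a b) :
      lo + 1 ≤ a ∧ a < lo + k + 2 ∧ lo + 2 ≤ b ∧ b ≤ lo + k + 2 := by
    have h1 := h.mem_of_append_singleton
    have h2 : b ∈ V ++ [lo + k + 2] := h.mem_of_cons
    have := hf.2.2 a
    have := hf.2.2 b
    grind
  have e1 a b : Step ((lo + (k + 1) + 1) :: lo :: (lo + 1) :: V ++ [lo + (k + 1) + 1]) a b ↔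
      (a = lo + k + 2 ∧ b = lo) ∨ (a = lo ∧ b = lo + 1) ∨
        Step ((lo + 1) :: V ++ [lo + k + 2]) a b := by
    simp [add_assoc]
  have e2 a b : Step ((lo + 1 + k + 1) :: (lo + 1) :: V ++ [lo + 1 + k + 1]) a b ↔
      (a = lo + k + 2 ∧ b = lo + 1) ∨ Step ((lo + 1) :: V ++ [lo + k + 2]) a b := by
    rw [show lo + 1 + k + 1 = lo + k + 2 by ring]
    simp
  simp only [GraphAvoids, e1, e2]
  generalize Step ((lo + 1) :: V ++ [lo + k + 2]) = P at hle
  clear e1 e2 hf hV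
  constructor <;> intro h a b c x y z ha hb hc hab hbc
    <;> have := hle a x <;> have := hle b y <;> have := hle c z <;> clear hle
  · have h1 := h a b c x y z
    clear h
    grind
  · have h1 := h a b c x y z
    clear h
    grind

theorem cons_cons_mem_minLast_iff {lo k : ℕ} {V : List ℕ} (hV : V ≠ []) :
    (lo + 1) :: (lo + k + 2) :: V ∈ minLast lo (k + 2) ↔ V ∈ minLast (lo + 1) k := by
  unfold minLast
  have hf' := fills_cons_max_iff (lo := lo + 1) (k := k) hV
  rw [show lo + 1 + k + 1 = lo + k + 2 by ring] at hf'
  simp only [Set.mem_ofPred_eq, fills_cons_iff (List.cons_ne_nil _ _), hf']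
  refine and_congr_right fun hf => ?_
  rw [wordAvoids_cons_of_forall, wordAvoids_cons_of_forall]
  rotate_left
  · exact .inr fun y hy => by have := (hf.2.2 y).1 hy; omega
  · refine .inl fun y hy => ?_
    have := hf.2.2 y
    grind
  refine and_congr_right fun _ => ?_
  obtain ⟨W, l, rfl⟩ := (List.eq_nil_or_concat' V).resolve_left hV
  have hl : lo + 2 ≤ l ∧ l < lo + k + 2 := by have := hf.2.2 l; grind
  have hle a b (h : Step ((lo + k + 2) :: W ++ [l]) a b) :
      lo + 2 ≤ a ∧ a ≤ lo + k + 2 ∧ lo + 2 ≤ b ∧ b < lo + k + 2 := by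
    have h1 := h.mem_of_append_singleton
    have h2 : b ∈ W ++ [l] := h.mem_of_cons
    have := hf.2.2 a
    have := hf.2.2 b
    grind
  have e1 a b : Step ((lo + (k + 2) + 1) :: (lo + 1) :: (lo + k + 2) :: (W ++ [l]) ++
      [lo, lo + (k + 2) + 1]) a b ↔ (a = lo + k + 3 ∧ b = lo + 1) ∨ (a = lo + 1 ∧ b = lo + k + 2) ∨
        Step ((lo + k + 2) :: W ++ [l]) a b ∨ (a = l ∧ b = lo) ∨ (a = lo ∧ b = lo + k + 3) := by
    have := step_append_cons ((lo + k + 2) :: W) l [lo, lo + k + 3] a b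
    simp only [List.cons_append, List.append_assoc, List.nil_append, step_cons_cons,
      step_singleton, or_false, add_assoc, Nat.reduceAdd] at this ⊢
    rw [this]
  have e2 a b : Step ((lo + 1 + k + 1) :: (W ++ [l]) ++ [lo + 1, lo + 1 + k + 1]) a b ↔
      Step ((lo + k + 2) :: W ++ [l]) a b ∨ (a = l ∧ b = lo + 1) ∨
        (a = lo + 1 ∧ b = lo + k + 2) := by
    have := step_append_cons ((lo + k + 2) :: W) l [lo + 1, lo + k + 2] a b
    rw [show lo + 1 + k + 1 = lo + k + 2 by ring]
    simp only [List.cons_append, List.append_assoc, List.nil_append, step_cons_cons,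
      step_singleton, or_false] at this ⊢
    rw [this]
  simp only [GraphAvoids, e1, e2]
  generalize Step ((lo + k + 2) :: W ++ [l]) = P at hle
  clear e1 e2 hf hf' hV
  constructor <;> intro h a b c x y z ha hb hc hab hbc
    <;> have := hle a x <;> have := hle b y <;> have := hle c z <;> clear hle
  · have h1 := h a b c x y z
    have h2 := h a b c x lo z
    clear h
    grind
  · have h1 := h a b c x y z
    have h2 := h a b c x (lo + 1) z
    clear h
    grind

theorem cons_concat_mem_minSecond_iff {lo k : ℕ} {V : List ℕ} (hV : V ≠ []) :
    (lo + k + 2) :: (V ++ [lo + 1]) ∈ minSecond lo (k + 2) ↔ V ∈ minLast (lo + 1) k := by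
  unfold minLast minSecond
  have hf' := fills_cons_max_iff (lo := lo + 1) (k := k) hV
  rw [show lo + 1 + k + 1 = lo + k + 2 by ring] at hf'
  simp only [Set.mem_ofPred_eq, ← List.cons_append, fills_concat_iff (List.cons_ne_nil _ _), hf']
  refine and_congr_right fun hf => ?_
  rw [wordAvoids_concat_of_forall, wordAvoids_cons_of_forall]
  rotate_left
  · exact .inr fun y hy => by have := (hf.2.2 y).1 hy; omega
  · intro y hy
    have := hf.2.2 y
    grind
  refine and_congr_right fun _ => ?_
  have hle a b (h : Step ((lo + k + 2) :: V ++ [lo + 1]) a b) :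
      lo + 2 ≤ a ∧ a ≤ lo + k + 2 ∧ lo + 1 ≤ b ∧ b < lo + k + 2 := by
    have h1 := h.mem_of_append_singleton
    have h2 : b ∈ V ++ [lo + 1] := h.mem_of_cons
    have := hf.2.2 a
    have := hf.2.2 b
    grind
  have e1 a b : Step ((lo + (k + 2) + 1) :: lo :: (lo + k + 2) :: V ++ [lo + 1] ++
      [lo + (k + 2) + 1]) a b ↔ (a = lo + k + 3 ∧ b = lo) ∨ (a = lo ∧ b = lo + k + 2) ∨
        Step ((lo + k + 2) :: V ++ [lo + 1]) a b ∨ (a = lo + 1 ∧ b = lo + k + 3) := by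
    have := step_append_cons ((lo + k + 2) :: V) (lo + 1) [lo + k + 3] a b
    simp only [List.cons_append, List.append_assoc, List.nil_append, step_cons_cons,
      step_singleton, or_false, add_assoc, Nat.reduceAdd] at this ⊢
    rw [this]
  have e2 a b : Step ((lo + 1 + k + 1) :: V ++ [lo + 1, lo + 1 + k + 1]) a b ↔
      Step ((lo + k + 2) :: V ++ [lo + 1]) a b ∨ (a = lo + 1 ∧ b = lo + k + 2) := by
    rw [step_append_cons, show lo + 1 + k + 1 = lo + k + 2 by ring]
    simp
  simp only [GraphAvoids, e1, e2]
  generalize Step ((lo + k + 2) :: V ++ [lo + 1]) = P at hle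
  clear e1 e2 hf hf' hV
  constructor <;> intro h a b c x y z ha hb hc hab hbc
    <;> have := hle a x <;> have := hle b y <;> have := hle c z <;> clear hle
  · have h1 := h a b c x y z
    clear h
    grind
  · have h1 := h a b c x y z
    clear h
    grind

theorem wordAvoids_of_pairwise_lt {V : List ℕ} (h : V.Pairwise (· < ·)) : WordAvoids V := by
  induction V with
  | nil => exact .nil
  | cons x V ih =>
    rw [List.pairwise_cons] at h
    exact (wordAvoids_cons_of_forall (.inl fun y hy => (h.1 y hy).le)).2 (ih h.2)

theorem Step.of_range'_concat {s m z a b : ℕ} (h : Step (List.range' s m ++ [z]) a b) :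
    (b = a + 1 ∧ s ≤ a ∧ a + 1 < s + m) ∨ (s ≤ a ∧ a + 1 = s + m ∧ b = z) := by
  induction m generalizing z with
  | zero => simp at h
  | succ m ih =>
    rw [List.range'_1_concat, List.append_assoc, List.singleton_append, step_append_pair] at h
    rcases h with h | h
    · have := ih h
      omega
    · omega

theorem range'_mem_minLast (lo k : ℕ) : List.range' (lo + 1) (k + 1) ∈ minLast lo (k + 1) := by
  refine ⟨fills_range' lo k, wordAvoids_of_pairwise_lt List.pairwise_lt_range', ?_⟩
  have e a b (h : Step ((lo + (k + 1) + 1) :: List.range' (lo + 1) (k + 1) ++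
      [lo, lo + (k + 1) + 1]) a b) : (a = lo + k + 2 ∧ b = lo + 1) ∨
        (b = a + 1 ∧ lo + 1 ≤ a ∧ a < lo + k + 1) ∨ (a = lo + k + 1 ∧ b = lo) ∨
          (a = lo ∧ b = lo + k + 2) := by
    rw [step_append_pair, List.range'_succ, List.cons_append, List.cons_append, step_cons_cons,
      ← List.cons_append, ← List.range'_succ] at h
    have := fun h => Step.of_range'_concat (s := lo + 1) (m := k + 1) (z := lo) (a := a) (b := b) h
    grind
  intro a b c x y z ha hb hc
  have := e a x ha
  have := e b y hb
  have := e c z hc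
  omega

theorem range'_concat_mem_minSecond (lo k : ℕ) :
    List.range' (lo + 2) (k + 1) ++ [lo + 1] ∈ minSecond lo (k + 2) := by
  refine ⟨(fills_concat_iff (by simp)).2 (fills_range' (lo + 1) k), ?_, ?_⟩
  · rw [wordAvoids_concat_of_forall]
    · exact wordAvoids_of_pairwise_lt List.pairwise_lt_range'
    · intro y hy
      rw [List.mem_range'_1] at hy
      omega
  have e a b (h : Step ((lo + (k + 2) + 1) :: lo :: (List.range' (lo + 2) (k + 1) ++ [lo + 1]) ++
      [lo + (k + 2) + 1]) a b) : (a = lo + k + 3 ∧ b = lo) ∨ (a = lo ∧ b = lo + 2) ∨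
        (b = a + 1 ∧ lo + 2 ≤ a ∧ a < lo + k + 2) ∨ (a = lo + k + 2 ∧ b = lo + 1) ∨
          (a = lo + 1 ∧ b = lo + k + 3) := by
    rw [List.cons_append, List.cons_append, step_cons_cons, List.append_assoc,
      List.singleton_append, ← List.cons_append, step_append_pair, List.range'_succ,
      List.cons_append, List.cons_append, step_cons_cons, ← List.cons_append,
      ← List.range'_succ] at h
    have := fun h => Step.of_range'_concat (s := lo + 2) (m := k + 1) (z := lo + 1) (a := a)
      (b := b) h
    grind
  intro a b c x y z ha hb hc
  have := e a x ha
  have := e b y hb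
  have := e c z hc
  omega

theorem Fills.length_eq {lo k : ℕ} {V : List ℕ} (h : Fills lo k V) : V.length = k := by
  have : V.Perm (List.range' (lo + 1) k) := by
    rw [List.perm_ext_iff_of_nodup h.2.1 List.nodup_range']
    intro x
    rw [h.2.2, List.mem_range'_1]
    omega
  simpa using this.length_eq

theorem minLast_zero (lo : ℕ) : minLast lo 0 = ∅ :=
  Set.eq_empty_of_forall_notMem fun _ h => h.1.1 (List.eq_nil_of_length_eq_zero h.1.length_eq)

theorem Fills.eq_singleton {lo : ℕ} {V : List ℕ} (h : Fills lo 1 V) : V = [lo + 1] := by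
  obtain ⟨x, rfl⟩ := List.length_eq_one_iff.1 h.length_eq
  exact h.eq_range' (by simp)

theorem minLast_one (lo : ℕ) : minLast lo 1 = {[lo + 1]} :=
  Set.eq_singleton_iff_unique_mem.2 ⟨range'_mem_minLast lo 0, fun _ h => h.1.eq_singleton⟩

theorem minSecond_one (lo : ℕ) : minSecond lo 1 = {[lo + 1]} := by
  refine Set.eq_singleton_iff_unique_mem.2 ⟨⟨fills_range' lo 0, by simp [WordAvoids], ?_⟩,
    fun _ h => h.1.eq_singleton⟩
  intro a b c x y z ha hb hc
  simp only [List.cons_append, List.nil_append, step_cons_cons, step_singleton, or_false] at ha hb hc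
  omega

/-- If the smallest letter of a `213`-avoiding word has letters on both sides, the first letter
exceeds the letter following the smallest one. -/
theorem WordAvoids.lt_head {u v x : ℕ} {s t : List ℕ} (h : WordAvoids (u :: s ++ x :: v :: t))
    (hd : (u :: s ++ x :: v :: t).Nodup) (hx : x < u) : v < u := by
  have h1 := h.not_lt_of_append_cons (y := u) (z := v) (by simp) (by simp)
  have h2 := (List.nodup_append.1 hd).2.2 u (by simp) v (by simp)
  omega

theorem minLast_add_two (lo k : ℕ) : minLast lo (k + 2) =
    {List.range' (lo + 1) (k + 2)} ∪ ((fun V => V ++ [lo + 1]) '' minLast (lo + 1) (k + 1) ∪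
      (fun V => (lo + 1) :: (lo + k + 2) :: V) '' minLast (lo + 1) k) := by
  refine Set.Subset.antisymm (fun V hV => ?_) ?_
  · obtain ⟨hf, hw, hg⟩ := id hV
    obtain ⟨s, t, rfl⟩ := List.append_of_mem ((hf.2.2 (lo + 1)).2 (by omega))
    have hlen := hf.length_eq
    rcases s with _ | ⟨u, s⟩
    · rcases t with _ | ⟨v, t⟩
      · simp at hlen
      · simp only [List.nil_append] at *
        have hf' := (fills_cons_iff (List.cons_ne_nil _ _)).1 hf
        have key := head_eq_or_pairwise_lt hg (v := v) (V := t) (M := lo + k + 2) (a := lo + 1)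
          (b := lo) (wordAvoids_cons.1 hw).2 hf'.2.1 ((hf'.2.2 _).2 (by omega))
          (fun x hx => by have := (hf'.2.2 x).1 hx; omega)
          (fun x hx => by have := (hf'.2.2 x).1 hx; omega)
          (fun x hx => by have := (hf'.2.2 x).1 hx; omega) (fun x y h => ?_)
        · rcases key with rfl | key
          · rcases eq_or_ne t [] with rfl | ht
            · simp only [List.length_cons, List.length_nil] at hlen
              obtain rfl : k = 0 := by omega
              left
              simp [List.range'_succ]
            · exact .inr (.inr ⟨t, (cons_cons_mem_minLast_iff ht).1 hV, rfl⟩)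
          · left
            exact hf.eq_range' (List.pairwise_cons.2
              ⟨fun x hx => by have := (hf'.2.2 x).1 hx; omega, key⟩)
        · have := (step_append_pair ((lo + (k + 2) + 1) :: (lo + 1) :: v :: t) lo
            (lo + (k + 2) + 1) x y).2 (.inl (by
              simp only [List.cons_append, step_cons_cons] at h ⊢; exact .inr h))
          exact this
    · rcases t with _ | ⟨v, t⟩
      · exact .inr (.inl ⟨u :: s, (concat_mem_minLast_iff (by simp)).1 hV, rfl⟩)
      · exfalso
        have hu := (hf.2.2 u).1 (by simp)
        have hne : u ≠ lo + 1 := (List.nodup_append.1 hf.2.1).2.2 u (by simp) (lo + 1) (by simp)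
        have hlt := hw.lt_head hf.2.1 (by omega)
        obtain ⟨l, hl, hstep⟩ := exists_step_append_cons (u := v :: t) (by simp) lo
          [lo + (k + 2) + 1]
        have htail x y (h : Step ((lo + 1) :: (v :: t ++ [lo, lo + (k + 2) + 1])) x y) :
            Step ((lo + (k + 2) + 1) :: (u :: s ++ (lo + 1) :: v :: t) ++
              [lo, lo + (k + 2) + 1]) x y := by
          have := (step_append_cons ((lo + (k + 2) + 1) :: u :: s) (lo + 1)
            (v :: t ++ [lo, lo + (k + 2) + 1]) x y).2 (.inr h)
          simpa using this
        have hl' := (hf.2.2 l).1 (by simp_all)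
        have hl'' : l ≠ lo + 1 := by
          rintro rfl
          exact (List.nodup_cons.1 (List.nodup_append.1 hf.2.1).2.1).1 hl
        have := hg _ _ _ _ _ _ (htail (lo + 1) v (by simp))
          (htail l lo ((step_cons_cons ..).2 (.inr hstep)))
          (show Step _ (lo + (k + 2) + 1) u by simp)
        have hv := (hf.2.2 v).1 (by simp)
        omega
  · rintro V (rfl | ⟨W, hW, rfl⟩ | ⟨W, hW, rfl⟩)
    · exact range'_mem_minLast lo (k + 1)
    · exact (concat_mem_minLast_iff hW.1.1).2 hW
    · exact (cons_cons_mem_minLast_iff hW.1.1).2 hW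

theorem minSecond_add_two (lo k : ℕ) : minSecond lo (k + 2) =
    {List.range' (lo + 2) (k + 1) ++ [lo + 1]} ∪
      ((fun V => (lo + 1) :: V) '' minSecond (lo + 1) (k + 1) ∪
        (fun V => (lo + k + 2) :: (V ++ [lo + 1])) '' minLast (lo + 1) k) := by
  refine Set.Subset.antisymm (fun V hV => ?_) ?_
  · obtain ⟨hf, hw, hg⟩ := id hV
    obtain ⟨s, t, rfl⟩ := List.append_of_mem ((hf.2.2 (lo + 1)).2 (by omega))
    have hlen := hf.length_eq
    rcases t with _ | ⟨v, t⟩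
    · rcases s with _ | ⟨u, s⟩
      · simp at hlen
      · have hf' := (fills_concat_iff (List.cons_ne_nil _ _)).1 hf
        have key := head_eq_or_pairwise_lt hg (v := u) (V := s) (M := lo + k + 2) (a := lo)
          (b := lo + 1) (List.triplewise_append.1 hw).1 hf'.2.1 ((hf'.2.2 _).2 (by omega))
          (fun x hx => by have := (hf'.2.2 x).1 hx; omega)
          (fun x hx => by have := (hf'.2.2 x).1 hx; omega)
          (fun x hx => by have := (hf'.2.2 x).1 hx; omega) (fun x y h => ?_)
        · rcases key with rfl | key
          · rcases eq_or_ne s [] with rfl | hs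
            · simp only [List.length_append, List.length_cons, List.length_nil] at hlen
              obtain rfl : k = 0 := by omega
              left
              simp
            · exact .inr (.inr ⟨s, (cons_concat_mem_minSecond_iff hs).1 hV, rfl⟩)
          · left
            rw [hf'.eq_range' key]
            rfl
        · have := (step_append_pair ((lo + (k + 2) + 1) :: lo :: u :: s) (lo + 1)
            (lo + (k + 2) + 1) x y).2 (.inl (by
              simp only [List.cons_append, step_cons_cons] at h ⊢; exact .inr h))
          simpa using this
    · rcases s with _ | ⟨u, s⟩
      · exact .inr (.inl ⟨v :: t, (cons_mem_minSecond_iff (by simp)).1 hV, rfl⟩)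
      · exfalso
        have hu := (hf.2.2 u).1 (by simp)
        have hne : u ≠ lo + 1 := (List.nodup_append.1 hf.2.1).2.2 u (by simp) (lo + 1) (by simp)
        have hlt := hw.lt_head hf.2.1 (by omega)
        obtain ⟨l, hl, hstep⟩ := exists_step_append_cons (u := v :: t) (by simp)
          (lo + (k + 2) + 1) []
        have htail x y (h : Step ((lo + 1) :: (v :: t ++ [lo + (k + 2) + 1])) x y) :
            Step ((lo + (k + 2) + 1) :: lo :: (u :: s ++ (lo + 1) :: v :: t) ++
              [lo + (k + 2) + 1]) x y := by
          have := (step_append_cons ((lo + (k + 2) + 1) :: lo :: u :: s) (lo + 1)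
            (v :: t ++ [lo + (k + 2) + 1]) x y).2 (.inr h)
          simpa using this
        have hl' := (hf.2.2 l).1 (by simp_all)
        have hl'' : l ≠ lo + 1 := by
          rintro rfl
          exact (List.nodup_cons.1 (List.nodup_append.1 hf.2.1).2.1).1 hl
        have := hg _ _ _ _ _ _ (show Step _ lo u by simp) (htail (lo + 1) v (by simp))
          (htail l _ ((step_cons_cons ..).2 (.inr hstep)))
        omega
  · rintro V (rfl | ⟨W, hW, rfl⟩ | ⟨W, hW, rfl⟩)
    · exact range'_concat_mem_minSecond lo k
    · exact (cons_mem_minSecond_iff hW.1.1).2 hW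
    · exact (cons_concat_mem_minSecond_iff hW.1.1).2 hW

theorem encard_three {α : Type*} {a : α} {s t : Set α} (hs : a ∉ s) (ht : a ∉ t)
    (hst : Disjoint s t) : ({a} ∪ (s ∪ t)).encard = 1 + (s.encard + t.encard) := by
  rw [Set.encard_union_eq (by simp [hs, ht]), Set.encard_singleton, Set.encard_union_eq hst]

theorem encard_minLast_add_two (lo k : ℕ) : (minLast lo (k + 2)).encard =
    1 + ((minLast (lo + 1) (k + 1)).encard + (minLast (lo + 1) k).encard) := by
  have hinj1 : Function.Injective fun V : List ℕ => V ++ [lo + 1] :=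
    fun _ _ h => by simpa using h
  have hinj2 : Function.Injective fun V : List ℕ => (lo + 1) :: (lo + k + 2) :: V :=
    fun _ _ h => by simpa using h
  rw [minLast_add_two, encard_three, hinj1.encard_image, hinj2.encard_image]
  · rintro ⟨V, hV, h⟩
    rcases V with _ | ⟨v, V⟩
    · exact hV.1.1 rfl
    · simp only [List.range'_succ, List.cons_append, List.cons.injEq] at h
      have := (hV.1.2.2 v).1 (by simp)
      omega
  · rintro ⟨V, hV, h⟩
    rcases V with _ | ⟨v, V⟩
    · exact hV.1.1 rfl
    · have := hV.1.length_eq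
      simp only [List.range'_succ, List.cons.injEq] at h
      simp only [List.length_cons] at this
      omega
  · rw [Set.disjoint_left]
    rintro _ ⟨V, hV, rfl⟩ ⟨W, hW, h⟩
    rcases V with _ | ⟨v, V⟩
    · exact hV.1.1 rfl
    · simp only [List.cons_append, List.cons.injEq] at h
      have := (hV.1.2.2 v).1 (by simp)
      omega

theorem encard_minSecond_add_two (lo k : ℕ) : (minSecond lo (k + 2)).encard =
    1 + ((minSecond (lo + 1) (k + 1)).encard + (minLast (lo + 1) k).encard) := by
  have hinj1 : Function.Injective fun V : List ℕ => (lo + 1) :: V :=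
    fun _ _ h => by simpa using h
  have hinj2 : Function.Injective fun V : List ℕ => (lo + k + 2) :: (V ++ [lo + 1]) :=
    fun _ _ h => by simpa using h
  rw [minSecond_add_two, encard_three, hinj1.encard_image, hinj2.encard_image]
  · rintro ⟨V, hV, h⟩
    simp only [List.range'_succ, List.cons_append, List.cons.injEq] at h
    omega
  · rintro ⟨V, hV, h⟩
    rcases V with _ | ⟨v, V⟩
    · exact hV.1.1 rfl
    · have := hV.1.length_eq
      simp only [List.range'_succ, List.cons_append, List.cons.injEq] at h
      simp only [List.length_cons] at this
      omega
  · rw [Set.disjoint_left]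
    rintro _ ⟨V, hV, rfl⟩ ⟨W, hW, h⟩
    simp only [List.cons.injEq] at h
    omega

theorem encard_minLast_add_one (lo k : ℕ) : (minLast lo k).encard + 1 = Nat.fib (k + 2) := by
  induction k using Nat.twoStepInduction generalizing lo with
  | zero => simp [minLast_zero]
  | one => rw [minLast_one, Set.encard_singleton]; rfl
  | more k ih1 ih2 =>
    rw [encard_minLast_add_two, Nat.fib_add_two (n := k + 2), Nat.cast_add, ← ih1 (lo + 1),
      ← ih2 (lo + 1)]
    ring

theorem encard_minSecond_add_one (lo k : ℕ) :
    (minSecond lo (k + 1)).encard + 1 = Nat.fib (k + 3) := by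
  induction k generalizing lo with
  | zero => rw [minSecond_one, Set.encard_singleton]; rfl
  | succ k ih =>
    rw [encard_minSecond_add_two, Nat.fib_add_two (n := k + 2), Nat.cast_add, ← ih (lo + 1),
      ← encard_minLast_add_one (lo + 1)]
    ring

/-- The words `T` such that the cycle `(m, T)` on `{0, …, m}` and its one-line notation
avoid `213`. -/
def cycleTails (m : ℕ) : Set (List ℕ) :=
  {T | T.Nodup ∧ (∀ x, x ∈ T ↔ x < m) ∧ WordAvoids T ∧ GraphAvoids (Step (m :: T ++ [m]))}

theorem cons_zero_mem_cycleTails_iff {k : ℕ} {V : List ℕ} :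
    0 :: V ∈ cycleTails (k + 2) ↔ V ∈ minSecond 0 (k + 1) := by
  have hf : (0 :: V).Nodup ∧ (∀ x, x ∈ 0 :: V ↔ x < k + 2) ↔ Fills 0 (k + 1) V := by
    simp only [Fills, List.nodup_cons, List.mem_cons]
    constructor
    · rintro ⟨⟨h1, h2⟩, h3⟩
      refine ⟨List.ne_nil_of_mem (a := 1) ?_, h2, fun x => ?_⟩
      · have := h3 1; grind
      · have := h3 x
        by_cases hx : x = 0
        · subst hx; simp [h1]
        · grind
    · rintro ⟨-, h2, h3⟩
      have := h3 0
      grind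
  unfold cycleTails minSecond
  rw [Set.mem_ofPred_eq, Set.mem_ofPred_eq, ← and_assoc, hf,
    wordAvoids_cons_of_forall (.inl fun _ _ => Nat.zero_le _), zero_add]

theorem concat_zero_mem_cycleTails_iff {k : ℕ} {V : List ℕ} :
    V ++ [0] ∈ cycleTails (k + 2) ↔ V ∈ minLast 0 (k + 1) := by
  have hf : (V ++ [0]).Nodup ∧ (∀ x, x ∈ V ++ [0] ↔ x < k + 2) ↔ Fills 0 (k + 1) V := by
    rw [(List.perm_append_singleton 0 V).nodup_iff]
    simp only [Fills, List.nodup_cons, List.mem_append, List.mem_singleton]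
    constructor
    · rintro ⟨⟨h1, h2⟩, h3⟩
      refine ⟨List.ne_nil_of_mem (a := 1) ?_, h2, fun x => ?_⟩
      · have := h3 1; grind
      · have := h3 x
        by_cases hx : x = 0
        · subst hx; simp [h1]
        · grind
    · rintro ⟨-, h2, h3⟩
      have := h3 0
      grind
  unfold cycleTails minLast
  rw [Set.mem_ofPred_eq, Set.mem_ofPred_eq, ← and_assoc, hf,
    wordAvoids_concat_of_forall (fun _ _ => Nat.zero_le _), zero_add]
  simp [add_assoc]

theorem cycleTails_add_two (k : ℕ) : cycleTails (k + 2) =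
    (List.cons 0 '' minSecond 0 (k + 1)) ∪ ((· ++ [0]) '' minLast 0 (k + 1)) := by
  ext T
  constructor
  · intro hT
    obtain ⟨s, t, rfl⟩ := List.append_of_mem ((hT.2.1 0).2 (by omega))
    cases s with
    | nil => exact .inl ⟨t, cons_zero_mem_cycleTails_iff.1 hT, rfl⟩
    | cons u s =>
      cases t with
      | nil => exact .inr ⟨_, concat_zero_mem_cycleTails_iff.1 hT, rfl⟩
      | cons v t =>
        exfalso
        obtain ⟨hd, hmem, hw, hg⟩ := hT
        obtain ⟨hd1, hd2, hd3⟩ := List.nodup_append.1 hd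
        have hu : 0 < u := Nat.pos_of_ne_zero fun h => hd3 u (by simp) 0 (by simp) h
        have hv : 0 < v := Nat.pos_of_ne_zero fun h => by subst h; simp at hd2
        obtain ⟨p, hp, hstep⟩ := exists_step_append_cons (u := u :: s) (by simp) 0
          (v :: t ++ [k + 2])
        have hp0 : 0 < p := Nat.pos_of_ne_zero fun h => hd3 p hp 0 (by simp) h
        have hpm := (hmem p).1 (List.mem_append.2 (.inl hp))
        rw [show (k + 2) :: (u :: s ++ 0 :: v :: t) ++ [k + 2] =
          (k + 2) :: (u :: s ++ 0 :: (v :: t ++ [k + 2])) by simp] at hg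
        refine hg 0 p (k + 2) v 0 u ((step_append_cons ((k + 2) :: u :: s) ..).2 (.inr (by simp)))
          ((step_cons_cons ..).2 (.inr hstep)) (by simp) hp0 hpm ⟨hv, hw.lt_head hd hu⟩
  · rintro (⟨V, hV, rfl⟩ | ⟨V, hV, rfl⟩)
    · exact cons_zero_mem_cycleTails_iff.2 hV
    · exact concat_zero_mem_cycleTails_iff.2 hV

theorem encard_cycleTails_add_two (k : ℕ) :
    (cycleTails (k + 2)).encard + 2 = (2 * Nat.fib (k + 3) : ℕ) := by
  have hdisj : Disjoint (List.cons 0 '' minSecond 0 (k + 1)) ((· ++ [0]) '' minLast 0 (k + 1)) := by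
    rw [Set.disjoint_left]
    rintro _ ⟨V, hV, rfl⟩ ⟨W, hW, h⟩
    obtain ⟨w, W, rfl⟩ := List.exists_cons_of_ne_nil hW.1.1
    have h0 := (hW.1.2.2 w).1 (by simp)
    simp only [List.cons_append, List.cons.injEq] at h
    omega
  rw [cycleTails_add_two, Set.encard_union_eq hdisj, List.cons_injective.encard_image,
    (List.append_left_injective [0]).encard_image, two_mul, Nat.cast_add]
  nth_rewrite 1 [← encard_minSecond_add_one 0 k]
  rw [← encard_minLast_add_one 0 (k + 1), ← one_add_one_eq_two]
  abel

theorem step_iff_getElem {l : List ℕ} {a b : ℕ} :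
    Step l a b ↔ ∃ (i : ℕ) (h : i + 1 < l.length), a = l[i] ∧ b = l[i + 1] := by
  induction l with
  | nil => simp
  | cons x l ih =>
    cases l with
    | nil => simp
    | cons y l =>
      rw [step_cons_cons, ih]
      constructor
      · rintro (⟨rfl, rfl⟩ | ⟨i, h, rfl, rfl⟩)
        · exact ⟨0, by simp, rfl, rfl⟩
        · exact ⟨i + 1, by simpa using h, rfl, rfl⟩
      · rintro ⟨_ | i, h, rfl, rfl⟩
        · exact .inl ⟨rfl, rfl⟩
        · exact .inr ⟨i, by simpa using h, rfl, rfl⟩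

theorem avoids_p213_iff {n : ℕ} {σ : Equiv.Perm (Fin n)} :
    Avoids σ p213 ↔ ∀ i j k, i < j → j < k → ¬ (σ j < σ i ∧ σ i < σ k) := by
  have h0 : p213 0 = 1 := rfl
  have h1 : p213 1 = 0 := rfl
  have h2 : p213 2 = 2 := rfl
  unfold Avoids Contains
  constructor
  · rintro h i j k hij hjk ⟨hji, hik⟩
    refine h ⟨![i, j, k], ?_, ?_⟩
    · rw [Fin.strictMono_iff_lt_succ]
      simp [Fin.forall_fin_two, hij, hjk]
    · simp [Fin.forall_fin_succ, h0, h1, h2, hji, hik, hji.trans hik, hji.le, hik.le,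
        (hji.trans hik).le]
  · rintro h ⟨f, hf, hp⟩
    exact h (f 0) (f 1) (f 2) (hf (by decide)) (hf (by decide))
      ⟨(hp 1 0).2 (by simp [h0, h1]), (hp 0 2).2 (by simp [h0, h2])⟩

namespace IsCyclicPerm

variable {n : ℕ} {π : Equiv.Perm (Fin n)}

theorem minimalPeriod_eq (hπ : IsCyclicPerm π) (x : Fin n) :
    Function.minimalPeriod π x = n := by
  refine le_antisymm ?_ ?_
  · simpa using Function.minimalPeriod_le_card (f := π) (x := x)
  · have hpos : 0 < Function.minimalPeriod π x :=
      Function.minimalPeriod_pos_of_mem_periodicPts (π.injective.mem_periodicPts x)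
    have : Function.Surjective
        (fun i : Fin (Function.minimalPeriod π x) => (π^[i] x : Fin n)) := fun y => by
      obtain ⟨k, rfl⟩ := hπ x y
      exact ⟨⟨k % _, Nat.mod_lt _ hpos⟩, Function.iterate_mod_minimalPeriod_eq⟩
    simpa using Fintype.card_le_of_surjective _ this

theorem bijective_iterate (hπ : IsCyclicPerm π) (x : Fin n) :
    Function.Bijective (fun i : Fin n => π^[i] x) := by
  rw [← Finite.injective_iff_bijective]
  intro i j hij
  refine Fin.ext (Function.iterate_injOn_Iio_minimalPeriod (f := π) (x := x) ?_ ?_ hij)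
  · rw [hπ.minimalPeriod_eq]; exact i.2
  · rw [hπ.minimalPeriod_eq]; exact j.2

theorem iterate_eq_self (hπ : IsCyclicPerm π) (x : Fin n) : π^[n] x = x := by
  simpa [hπ.minimalPeriod_eq] using Function.iterate_minimalPeriod (f := π) (x := x)

end IsCyclicPerm

theorem fundWord_eq {m : ℕ} {π : Equiv.Perm (Fin (m + 1))} (hπ : IsCyclicPerm π) :
    fundWord π = (List.finRange (m + 1)).map fun i : Fin (m + 1) => π^[i] (Fin.last m) := by
  have hp (x : Fin (m + 1)) :
      ((List.range (m + 1)).all fun k => decide ((⇑π)^[k] x ≤ x)) = (x == Fin.last m) := by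
    rw [Bool.eq_iff_iff]
    simp only [List.all_eq_true, List.mem_range, decide_eq_true_eq, beq_iff_eq]
    constructor
    · intro h
      obtain ⟨i, hi⟩ := (hπ.bijective_iterate x).2 (Fin.last m)
      exact le_antisymm (Fin.le_last x) (hi ▸ h i i.2)
    · rintro rfl k -
      exact Fin.le_last _
  unfold fundWord
  simp only [hp]
  rw [List.filter_beq, List.count_eq_one_of_mem (List.nodup_finRange _) (List.mem_finRange _)]
  simp only [List.replicate_one, List.flatMap_singleton, hπ.minimalPeriod_eq]
  rw [← List.map_coe_finRange_eq_range, List.map_map]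
  rfl

theorem theta_apply {m : ℕ} {π : Equiv.Perm (Fin (m + 1))} (hπ : IsCyclicPerm π)
    (i : Fin (m + 1)) : theta π i = π^[i] (Fin.last m) := by
  have hinj : Function.Injective
      (fun σ : Equiv.Perm (Fin (m + 1)) => (List.finRange (m + 1)).map ⇑σ) := by
    intro σ τ h
    ext1 i
    exact List.map_inj_left.1 h i (List.mem_finRange i)
  have : theta π = Equiv.ofBijective _ (hπ.bijective_iterate (Fin.last m)) := by
    unfold theta permOfWord
    rw [fundWord_eq hπ]
    exact Function.leftInverse_invFun hinj (Equiv.ofBijective _ (hπ.bijective_iterate _))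
  rw [this]
  rfl

/-- The word read along the orbit of the largest letter, without that letter. -/
def orbitTail {m : ℕ} (π : Equiv.Perm (Fin (m + 1))) : List ℕ :=
  (List.range m).map fun i => (π^[i + 1] (Fin.last m) : ℕ)

theorem cons_orbitTail {m : ℕ} (π : Equiv.Perm (Fin (m + 1))) :
    m :: orbitTail π = (List.range (m + 1)).map fun i => (π^[i] (Fin.last m) : ℕ) := by
  simp [orbitTail, List.range_succ_eq_map]

theorem cons_orbitTail_concat {m : ℕ} {π : Equiv.Perm (Fin (m + 1))} (hπ : IsCyclicPerm π) :
    m :: orbitTail π ++ [m] = (List.range (m + 2)).map fun i => (π^[i] (Fin.last m) : ℕ) := by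
  rw [cons_orbitTail, List.range_succ (n := m + 1), List.map_append, List.map_singleton,
    hπ.iterate_eq_self, Fin.val_last]

theorem step_orbitTail_iff {m : ℕ} {π : Equiv.Perm (Fin (m + 1))} (hπ : IsCyclicPerm π)
    {a b : ℕ} : Step (m :: orbitTail π ++ [m]) a b ↔ ∃ i : Fin (m + 1), a = i ∧ b = π i := by
  rw [cons_orbitTail_concat hπ, step_iff_getElem]
  simp only [List.length_map, List.length_range, List.getElem_map, List.getElem_range]
  constructor
  · rintro ⟨i, -, rfl, rfl⟩
    exact ⟨_, rfl, by rw [Function.iterate_succ_apply']⟩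
  · rintro ⟨x, rfl, rfl⟩
    obtain ⟨i, rfl⟩ := (hπ.bijective_iterate (Fin.last m)).2 x
    exact ⟨i, by omega, rfl, by rw [Function.iterate_succ_apply']⟩

theorem graphAvoids_orbitTail_iff {m : ℕ} {π : Equiv.Perm (Fin (m + 1))} (hπ : IsCyclicPerm π) :
    GraphAvoids (Step (m :: orbitTail π ++ [m])) ↔ Avoids π p213 := by
  rw [avoids_p213_iff]
  simp only [GraphAvoids, step_orbitTail_iff hπ]
  constructor
  · intro h i j k hij hjk
    exact h i j k _ _ _ ⟨i, rfl, rfl⟩ ⟨j, rfl, rfl⟩ ⟨k, rfl, rfl⟩ hij hjk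
  · rintro h _ _ _ _ _ _ ⟨i, rfl, rfl⟩ ⟨j, rfl, rfl⟩ ⟨k, rfl, rfl⟩ hij hjk
    exact h i j k hij hjk

theorem nodup_cons_orbitTail {m : ℕ} {π : Equiv.Perm (Fin (m + 1))} (hπ : IsCyclicPerm π) :
    (m :: orbitTail π).Nodup := by
  rw [cons_orbitTail, List.nodup_map_iff_inj_on List.nodup_range]
  intro i hi j hj h
  rw [List.mem_range] at hi hj
  exact Fin.mk.inj ((hπ.bijective_iterate (Fin.last m)).1 (a₁ := ⟨i, hi⟩) (a₂ := ⟨j, hj⟩)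
    (Fin.ext h))

theorem mem_cons_orbitTail_iff {m : ℕ} {π : Equiv.Perm (Fin (m + 1))} (hπ : IsCyclicPerm π)
    {x : ℕ} : x ∈ m :: orbitTail π ↔ x < m + 1 := by
  rw [cons_orbitTail, List.mem_map]
  constructor
  · rintro ⟨i, -, rfl⟩
    exact Fin.is_lt _
  · intro hx
    obtain ⟨i, hi⟩ := (hπ.bijective_iterate (Fin.last m)).2 ⟨x, hx⟩
    exact ⟨i, List.mem_range.2 i.2, congrArg Fin.val hi⟩

theorem mem_orbitTail_iff {m : ℕ} {π : Equiv.Perm (Fin (m + 1))} (hπ : IsCyclicPerm π)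
    {x : ℕ} : x ∈ orbitTail π ↔ x < m := by
  have h1 := mem_cons_orbitTail_iff hπ (x := x)
  have h2 := (List.nodup_cons.1 (nodup_cons_orbitTail hπ)).1
  rw [List.mem_cons] at h1
  grind

theorem wordAvoids_orbitTail_iff {m : ℕ} {π : Equiv.Perm (Fin (m + 1))} (hπ : IsCyclicPerm π) :
    WordAvoids (orbitTail π) ↔ Avoids (theta π) p213 := by
  rw [← wordAvoids_cons_of_forall (x := m) (.inr fun y hy => ((mem_orbitTail_iff hπ).1 hy).le),
    avoids_p213_iff, cons_orbitTail, WordAvoids, List.triplewise_iff_getElem]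
  simp only [theta_apply hπ, List.length_map, List.length_range, List.getElem_map,
    List.getElem_range, Fin.lt_def]
  exact ⟨fun h i j k hij hjk => h i j k hij hjk k.2, fun h i j k hij hjk hk =>
    h ⟨i, by omega⟩ ⟨j, by omega⟩ ⟨k, hk⟩ hij hjk⟩

theorem orbitTail_mem_cycleTails_iff {m : ℕ} {π : Equiv.Perm (Fin (m + 1))}
    (hπ : IsCyclicPerm π) :
    orbitTail π ∈ cycleTails m ↔ Avoids π p213 ∧ Avoids (theta π) p213 := by
  rw [cycleTails, Set.mem_ofPred_eq, graphAvoids_orbitTail_iff hπ, wordAvoids_orbitTail_iff hπ]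
  simp only [mem_orbitTail_iff hπ, implies_true, true_and,
    (List.nodup_cons.1 (nodup_cons_orbitTail hπ)).2, and_comm]

theorem orbitTail_injOn {m : ℕ} :
    Set.InjOn orbitTail {π : Equiv.Perm (Fin (m + 1)) | IsCyclicPerm π} := by
  intro π hπ τ hτ h
  ext x
  obtain ⟨i, hi, hx⟩ := (step_orbitTail_iff hτ).1 (h ▸ (step_orbitTail_iff hπ).2 ⟨x, rfl, rfl⟩)
  rw [hx, ← Fin.ext hi]

theorem exists_orbitTail_eq {m : ℕ} {T : List ℕ} (hd : T.Nodup) (hT : ∀ x, x ∈ T ↔ x < m) :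
    ∃ π : Equiv.Perm (Fin (m + 1)), IsCyclicPerm π ∧ orbitTail π = T := by
  have hlen : T.length = m := by
    rw [← List.length_range (n := m)]
    exact ((List.perm_ext_iff_of_nodup hd List.nodup_range).2 (by simpa using hT)).length_eq
  obtain ⟨L, hL⟩ : m :: T ∈ Set.range (List.map (Fin.val : Fin (m + 1) → ℕ)) := by
    rw [Set.range_list_map]
    intro x hx
    rw [List.mem_cons, hT] at hx
    exact ⟨⟨x, by omega⟩, rfl⟩
  have hLd : L.Nodup := by
    refine List.Nodup.of_map Fin.val ?_
    rw [hL, List.nodup_cons]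
    exact ⟨fun h => by simp [hT] at h, hd⟩
  have hLlen : L.length = m + 1 := by
    rw [← List.length_map (f := Fin.val), hL, List.length_cons, hlen]
  have hiter (i j : ℕ) (hi : i < L.length) : (L.formPerm)^[j] L[i] =
      L[(i + j) % L.length]'(Nat.mod_lt _ (by omega)) := by
    rw [← List.formPerm_pow_apply_getElem L hLd j i hi, Equiv.Perm.iterate_eq_pow]
  have hL0 : L[0] = Fin.last m := by
    ext
    rw [← List.getElem_map Fin.val (h := by simp [hLlen])]
    simp [hL]
  refine ⟨L.formPerm, fun x y => ?_, ?_⟩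
  · have hmem (x) : x ∈ L := by
      rw [← List.mem_map_of_injective Fin.val_injective, hL, List.mem_cons, hT]
      omega
    obtain ⟨i, hi, rfl⟩ := List.getElem_of_mem (hmem x)
    obtain ⟨j, hj, rfl⟩ := List.getElem_of_mem (hmem y)
    refine ⟨L.length - i + j, ?_⟩
    rw [hiter _ _ hi]
    congr 1
    rw [show i + (L.length - i + j) = j + L.length by omega, Nat.add_mod_right,
      Nat.mod_eq_of_lt hj]
  · refine List.cons_inj_right m |>.1 ?_
    rw [cons_orbitTail, ← hL, ← hL0]
    refine List.ext_getElem (by simp [hLlen]) fun i h1 h2 => ?_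
    simp only [List.getElem_map, List.getElem_range]
    rw [hiter]
    congr 2
    rw [zero_add, Nat.mod_eq_of_lt (by simpa using h2)]

theorem image_orbitTail (m : ℕ) : orbitTail '' {π : Equiv.Perm (Fin (m + 1)) |
    IsCyclicPerm π ∧ Avoids π p213 ∧ Avoids (theta π) p213} = cycleTails m := by
  ext T
  constructor
  · rintro ⟨π, ⟨hπ, h⟩, rfl⟩
    exact (orbitTail_mem_cycleTails_iff hπ).2 h
  · intro hT
    obtain ⟨π, hπ, rfl⟩ := exists_orbitTail_eq hT.1 hT.2.1
    exact ⟨π, ⟨hπ, (orbitTail_mem_cycleTails_iff hπ).1 hT⟩, rfl⟩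

/-- for `n ≥ 3`, the number of cyclic permutations `π` with `π` and
`θ(π)` avoiding `213` is `2 F_n − 2`. -/
theorem cyclic_t_n_213 (n : ℕ) (hn : 3 ≤ n) :
    Nat.card {π : Equiv.Perm (Fin n) //
        IsCyclicPerm π ∧ Avoids π p213 ∧ Avoids (theta π) p213} = 2 * Nat.fib n - 2 := by
  obtain ⟨k, rfl⟩ := Nat.exists_eq_add_of_le' hn
  have h := encard_cycleTails_add_two k
  rw [← image_orbitTail, (orbitTail_injOn.mono fun π hπ => hπ.1).encard_image,
    ← Set.Finite.cast_ncard_eq (Set.toFinite _)] at h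
  exact Nat.eq_sub_of_add_eq (by exact_mod_cast h)
end

section
/- For all n ≥ 1, the number of permutations π ∈ S_n such that both π and θ(π) avoid the pattern 231 is t_n(231) = 2^{n−1}. -/
theorem contains_p231_iff {n : ℕ} (π : Equiv.Perm (Fin n)) :
    Contains p231 π ↔ ∃ a b c, a < b ∧ b < c ∧ π c < π a ∧ π a < π b := by
  have h0 : p231 0 = 1 := rfl
  have h1 : p231 1 = 2 := rfl
  have h2 : p231 2 = 0 := rfl
  constructor
  · rintro ⟨f, hf, h⟩
    refine ⟨f 0, f 1, f 2, hf (by decide), hf (by decide), (h 2 0).2 ?_, (h 0 1).2 ?_⟩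
    · rw [h0, h2]; decide
    · rw [h0, h1]; decide
  · rintro ⟨a, b, c, hab, hbc, hca, hab'⟩
    refine ⟨![a, b, c], ?_, ?_⟩
    · intro i j hij
      fin_cases i <;> fin_cases j <;> simp_all [hab.trans hbc]
    · intro i j
      fin_cases i <;> fin_cases j <;>
        simp [h0, h1, h2, hca, hab', hca.trans hab', hca.le, hab'.le, (hca.trans hab').le]

theorem avoids_p231_iff_symm {n : ℕ} (π : Equiv.Perm (Fin n)) :
    Avoids π p231 ↔ ∀ a b c, c < a → a < b → π.symm a < π.symm b → ¬ π.symm b < π.symm c := by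
  rw [Avoids, contains_p231_iff]
  constructor
  · intro h a b c hca hab h1 h2
    exact h ⟨_, _, _, h1, h2, by simpa using hca, by simpa using hab⟩
  · rintro h ⟨a, b, c, h1, h2, h3, h4⟩
    exact h _ _ _ h3 h4 (by simpa using h1) (by simpa using h2)

/-- `M` is the largest element of its cycle. -/
def IsCycleMax {n : ℕ} (π : Equiv.Perm (Fin n)) (M : Fin n) : Prop :=
  ∀ k : ℕ, (⇑π)^[k] M ≤ M

/-- `u` is listed before `v` in the standard cycle form. -/
def CycleFormLT {n : ℕ} (π : Equiv.Perm (Fin n)) (u v : Fin n) : Prop :=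
  ∃ (M N : Fin n) (i j : ℕ), IsCycleMax π M ∧ IsCycleMax π N ∧
    i < Function.minimalPeriod π M ∧ j < Function.minimalPeriod π N ∧
    (⇑π)^[i] M = u ∧ (⇑π)^[j] N = v ∧ (M < N ∨ M = N ∧ i < j)

section

variable {n : ℕ} (π : Equiv.Perm (Fin n))

theorem perm_minimalPeriod_pos (x : Fin n) : 0 < Function.minimalPeriod π x :=
  Function.minimalPeriod_pos_of_mem_periodicPts (π.injective.mem_periodicPts x)

theorem perm_minimalPeriod_le (x : Fin n) : Function.minimalPeriod π x ≤ n := by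
  have h := Finset.card_le_card_of_injOn (s := Finset.range (Function.minimalPeriod π x))
    (t := Finset.univ) (fun k => (⇑π)^[k] x) (by simp)
    (fun a ha b hb hab => Function.iterate_injOn_Iio_minimalPeriod
      (by simpa using ha) (by simpa using hb) hab)
  simpa using h

theorem isCycleMax_iff (x : Fin n) :
    IsCycleMax π x ↔ ((List.range n).all fun k => decide ((⇑π)^[k] x ≤ x)) = true := by
  simp only [IsCycleMax, List.all_eq_true, List.mem_range, decide_eq_true_eq]
  refine ⟨fun h k _ => h k, fun h k => ?_⟩
  rw [← Function.iterate_mod_minimalPeriod_eq]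
  exact h _ ((Nat.mod_lt _ (perm_minimalPeriod_pos π x)).trans_le (perm_minimalPeriod_le π x))

theorem exists_iterate_iterate_eq (x : Fin n) (k : ℕ) : ∃ m, (⇑π)^[m] ((⇑π)^[k] x) = x := by
  refine ⟨k * Function.minimalPeriod π x - k, ?_⟩
  rw [← Function.iterate_add_apply, Nat.sub_add_cancel
    (Nat.le_mul_of_pos_right _ (perm_minimalPeriod_pos π x))]
  exact (Function.isPeriodicPt_minimalPeriod π x).const_mul k

theorem exists_isCycleMax (u : Fin n) :
    ∃ M i, IsCycleMax π M ∧ i < Function.minimalPeriod π M ∧ (⇑π)^[i] M = u := by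
  classical
  obtain ⟨M, hM, hmax⟩ := Finset.exists_max_image
    (Finset.univ.filter fun v => ∃ k, (⇑π)^[k] u = v) id ⟨u, by simp; exact ⟨0, rfl⟩⟩
  simp only [Finset.mem_filter, Finset.mem_univ, true_and, id] at hM hmax
  obtain ⟨k, rfl⟩ := hM
  obtain ⟨m, hm⟩ := exists_iterate_iterate_eq π u k
  refine ⟨_, m % Function.minimalPeriod π ((⇑π)^[k] u), fun j => hmax _ ⟨j + k, ?_⟩,
    Nat.mod_lt _ (perm_minimalPeriod_pos π _), ?_⟩
  · rw [Function.iterate_add_apply]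
  · rw [Function.iterate_mod_minimalPeriod_eq, hm]

variable {π}

theorem IsCycleMax.eq {M N : Fin n} (hM : IsCycleMax π M) (hN : IsCycleMax π N) {i j : ℕ}
    (h : (⇑π)^[i] M = (⇑π)^[j] N) : M = N := by
  apply le_antisymm
  · obtain ⟨m, hm⟩ := exists_iterate_iterate_eq π M i
    rw [← hm, h, ← Function.iterate_add_apply]
    exact hN _
  · obtain ⟨m, hm⟩ := exists_iterate_iterate_eq π N j
    rw [← hm, ← h, ← Function.iterate_add_apply]
    exact hM _

theorem CycleFormLT.asymm {u v : Fin n} (h : CycleFormLT π u v) : ¬ CycleFormLT π v u := by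
  obtain ⟨M, N, i, j, hM, hN, hi, hj, rfl, rfl, h⟩ := h
  rintro ⟨M', N', i', j', hM', hN', hi', hj', h1, h2, h'⟩
  obtain rfl := hM'.eq hN h1
  obtain rfl := hN'.eq hM h2
  rcases h with h | ⟨rfl, h⟩
  · rcases h' with h' | ⟨h', -⟩
    · exact h.not_gt h'
    · exact h.ne' h'
  · have e1 := Function.iterate_injOn_Iio_minimalPeriod (Set.mem_Iio.2 hi') (Set.mem_Iio.2 hj) h1
    have e2 := Function.iterate_injOn_Iio_minimalPeriod (Set.mem_Iio.2 hj') (Set.mem_Iio.2 hi) h2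
    subst e1 e2
    simp at h'
    omega

variable (π)

theorem pairwise_fundWord : (fundWord π).Pairwise (CycleFormLT π) := by
  rw [fundWord, List.pairwise_flatMap]
  constructor
  · intro M hM
    rw [List.mem_filter, ← isCycleMax_iff] at hM
    rw [List.pairwise_map]
    refine (List.pairwise_lt_range).imp_of_mem fun {i j} hi hj hij => ?_
    rw [List.mem_range] at hi hj
    exact ⟨M, M, i, j, hM.2, hM.2, hi, hj, rfl, rfl, Or.inr ⟨rfl, hij⟩⟩
  · refine ((List.pairwise_lt_finRange n).filter _).imp_of_mem fun {M N} hM hN hMN => ?_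
    rw [List.mem_filter, ← isCycleMax_iff] at hM hN
    simp only [List.mem_map, List.mem_range]
    rintro _ ⟨i, hi, rfl⟩ _ ⟨j, hj, rfl⟩
    exact ⟨M, N, i, j, hM.2, hN.2, hi, hj, rfl, rfl, Or.inl hMN⟩

theorem mem_fundWord (u : Fin n) : u ∈ fundWord π := by
  obtain ⟨M, i, hM, hi, h⟩ := exists_isCycleMax π u
  simp only [fundWord, List.mem_flatMap, List.mem_filter, ← isCycleMax_iff, List.mem_map,
    List.mem_range]
  exact ⟨M, ⟨List.mem_finRange _, hM⟩, i, hi, h⟩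

theorem nodup_fundWord : (fundWord π).Nodup :=
  (pairwise_fundWord π).imp fun {_ _} h e => by subst e; exact h.asymm h

theorem map_theta : (List.finRange n).map (theta π) = fundWord π := by
  have hlen : (fundWord π).length = n := by
    rw [← List.toFinset_card_of_nodup (nodup_fundWord π)]
    have : (fundWord π).toFinset = Finset.univ := by
      ext; simp [mem_fundWord]
    simp [this]
  have hinj : Function.Injective fun i : Fin n => (fundWord π)[(i : ℕ)]'(by omega) := by
    intro i j h
    exact Fin.ext ((nodup_fundWord π).getElem_inj_iff.1 h)
  refine Function.invFun_eq (f := fun σ : Equiv.Perm (Fin n) => (List.finRange n).map ⇑σ)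
    ⟨Equiv.ofBijective _ (Finite.injective_iff_bijective.1 hinj), ?_⟩
  apply List.ext_getElem
  · simp [hlen]
  · intro i h1 h2
    simp

theorem theta_symm_lt_iff (u v : Fin n) :
    (theta π).symm u < (theta π).symm v ↔ CycleFormLT π u v := by
  have key : ∀ a b : Fin n, a < b → CycleFormLT π (theta π a) (theta π b) := by
    intro a b hab
    have h := pairwise_fundWord π
    rw [← map_theta, List.pairwise_map, List.pairwise_iff_getElem] at h
    simpa using h a b (by simp) (by simp) hab
  have key' : ∀ a b, (theta π).symm a < (theta π).symm b → CycleFormLT π a b := by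
    intro a b h
    simpa using key _ _ h
  refine ⟨key' u v, fun h => ?_⟩
  rcases lt_trichotomy ((theta π).symm u) ((theta π).symm v) with h1 | h1 | h1
  · exact h1
  · rw [(theta π).symm.injective h1] at h
    exact (h.asymm h).elim
  · exact (h.asymm (key' _ _ h1)).elim

theorem avoids_theta_iff :
    Avoids (theta π) p231 ↔
      ∀ a b c, c < a → a < b → CycleFormLT π a b → ¬ CycleFormLT π b c := by
  simp only [avoids_p231_iff_symm, theta_symm_lt_iff]

variable {π}

theorem le_apply_add_one_of_avoids (h : Avoids π p231) (hθ : Avoids (theta π) p231) (x : Fin n) :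
    (x : ℕ) ≤ π x + 1 := by
  rw [avoids_theta_iff] at hθ
  by_contra! hx
  have hdec : ∀ i j, i < j → j < x → π x < π i → ¬ π i < π j := fun i j h1 h2 h3 h4 =>
    h ((contains_p231_iff π).2 ⟨i, j, x, h1, h2, h3, h4⟩)
  obtain ⟨M, i, hM, hi, hix⟩ := exists_isCycleMax π x
  have hstep : ∀ k, (⇑π)^[k + 1] M = π ((⇑π)^[k] M) := fun k => Function.iterate_succ_apply' _ _ _
  have hlast : (⇑π)^[Function.minimalPeriod π M] M = M := Function.iterate_minimalPeriod
  have hxM : x ≤ M := hix ▸ hM i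
  have hi1 : i + 1 < Function.minimalPeriod π M := by
    refine lt_of_le_of_ne hi fun e => ?_
    rw [← e, hstep, hix] at hlast
    rw [Fin.le_def, ← hlast] at hxM
    omega
  have hlt : ∀ a b, a < b → b < Function.minimalPeriod π M →
      CycleFormLT π ((⇑π)^[a] M) ((⇑π)^[b] M) := fun a b hab hb =>
    ⟨M, M, a, b, hM, hM, hab.trans hb, hb, rfl, rfl, Or.inr ⟨rfl, hab⟩⟩
  have hmid : ∀ y, π x < y → y < x →
      ∃ l, i < l ∧ l < Function.minimalPeriod π M ∧ (⇑π)^[l] M = y := by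
    intro y h1 h2
    obtain ⟨N, l, hN, hl, hly⟩ := exists_isCycleMax π y
    have hax : CycleFormLT π x (π x) := by
      have := hlt i (i + 1) (by omega) hi1
      rwa [hstep, hix] at this
    rcases lt_trichotomy M N with hMN | rfl | hMN
    · refine absurd ?_ (hθ x N y h2 (hxM.trans_lt hMN)
        ⟨M, N, i, 0, hM, hN, hi, perm_minimalPeriod_pos π N, hix, rfl, Or.inl hMN⟩)
      refine ⟨N, N, 0, l, hN, hN, perm_minimalPeriod_pos π N, hl, rfl, hly,
        Or.inr ⟨rfl, Nat.pos_of_ne_zero ?_⟩⟩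
      rintro rfl
      have e : N = y := hly
      exact absurd (hxM.trans_lt hMN) (by rw [e]; exact h2.not_gt)
    · refine ⟨l, ?_, hl, hly⟩
      by_contra! hli
      refine hθ y x (π x) h1 h2
        ⟨M, M, l, i, hM, hM, hl, hi, hly, hix, Or.inr ⟨rfl, lt_of_le_of_ne hli ?_⟩⟩ hax
      rintro rfl
      exact h2.ne (hly.symm.trans hix)
    · exact absurd hax (hθ y x (π x) h1 h2
        ⟨N, M, l, i, hN, hM, hl, hi, hly, hix, Or.inl hMN⟩)
  have hex : ∃ l, i < l ∧ l < Function.minimalPeriod π M ∧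
      π x < (⇑π)^[l] M ∧ (⇑π)^[l] M < x := by
    have h1 : (π x : ℕ) + 1 < n := by omega
    obtain ⟨l, hl, hl', e⟩ := hmid ⟨π x + 1, h1⟩ (by simp [Fin.lt_def]) (by simpa [Fin.lt_def])
    exact ⟨l, hl, hl', by rw [e]; simp [Fin.lt_def], by rw [e]; simpa [Fin.lt_def]⟩
  classical
  obtain ⟨hil, hlP, hay, hyx⟩ := Nat.find_spec hex
  have hmin := fun m => Nat.find_min hex (m := m)
  generalize Nat.find hex = l at hil hlP hay hyx hmin
  obtain ⟨l, rfl⟩ : ∃ l', l = l' + 1 := ⟨l - 1, by omega⟩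
  have hil' : i < l := by
    refine lt_of_le_of_ne (by omega) ?_
    rintro rfl
    rw [hstep, hix] at hay
    exact hay.false
  set z := (⇑π)^[l] M with hz
  set y := (⇑π)^[l + 1] M with hy
  have hzy : π z = y := (hstep l).symm
  have hza : z ≤ π x := by
    by_contra! hza
    rcases lt_trichotomy z x with hzx | hzx | hzx
    · exact hmin l (by omega) ⟨hil', by omega, hza, hzx⟩
    · rw [← hzy, hzx] at hay
      exact hay.false
    · refine hθ x z y hyx hzx ?_ (hlt l (l + 1) (by omega) hlP)
      have := hlt i l hil' (by omega)
      rwa [hix] at this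
  have hex2 : ∃ k, l + 1 < k ∧ k ≤ Function.minimalPeriod π M ∧ x ≤ (⇑π)^[k] M :=
    ⟨_, hlP, le_rfl, by rw [hlast]; exact hxM⟩
  obtain ⟨hlk, hkP, hxq⟩ := Nat.find_spec hex2
  have hmin2 := fun m => Nat.find_min hex2 (m := m)
  generalize Nat.find hex2 = k at hlk hkP hxq hmin2
  obtain ⟨k, rfl⟩ : ∃ k', k = k' + 1 := ⟨k - 1, by omega⟩
  have hpx : (⇑π)^[k] M < x := by
    rcases eq_or_lt_of_le (show l + 1 ≤ k by omega) with e | hlk'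
    · rw [← e]; exact hyx
    · by_contra! hc
      exact hmin2 k (by omega) ⟨hlk', by omega, hc⟩
  have hpz : (⇑π)^[k] M < z := by
    by_contra! hc
    rw [hstep] at hxq
    rcases hc.eq_or_lt with e | hc
    · rw [← e, hzy] at hxq
      exact hxq.not_gt hyx
    · exact hdec _ _ hc hpx (by rwa [hzy]) (by rw [hzy]; exact hyx.trans_le hxq)
  have hlk' : l + 1 < k := by
    refine lt_of_le_of_ne (by omega) ?_
    rintro rfl
    exact (hpz.trans_le hza).not_gt hay
  exact hθ z y _ hpz (hza.trans_lt hay) (hlt l (l + 1) (by omega) hlP) (hlt (l + 1) k hlk' (by omega))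

theorem avoids_of_le_apply_add_one (h : ∀ x : Fin n, (x : ℕ) ≤ π x + 1) : Avoids π p231 := by
  rw [Avoids, contains_p231_iff]
  rintro ⟨i, j, k, hij, hjk, hki, hij'⟩
  have hk := h k
  have hsub : insert i (insert j (Finset.Ioi k)) ⊆ (Finset.Ici k).map π.symm.toEmbedding := by
    intro p hp
    simp only [Finset.mem_map_equiv, Equiv.symm_symm, Finset.mem_Ici]
    simp only [Finset.mem_insert, Finset.mem_Ioi] at hp
    have hp' := h p
    rcases hp with rfl | rfl | hp <;> omega
  have hcard := Finset.card_le_card hsub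
  rw [Finset.card_insert_of_notMem, Finset.card_insert_of_notMem, Finset.card_map,
    Fin.card_Ici, Fin.card_Ioi] at hcard
  · omega
  · simp only [Finset.mem_Ioi]; omega
  · simp only [Finset.mem_insert, Finset.mem_Ioi]; omega

theorem iterate_cycleMax (h : ∀ x : Fin n, (x : ℕ) ≤ π x + 1) {M : Fin n} (hM : IsCycleMax π M) (i : ℕ)
    (hi : i < Function.minimalPeriod π M) : (((⇑π)^[i] M : Fin n) : ℕ) + i = M := by
  induction i using Nat.strong_induction_on with
  | _ i ih =>
    cases i with
    | zero => rfl
    | succ i =>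
      have h1 := ih i (by omega) (by omega)
      have h2 := h ((⇑π)^[i] M)
      rw [← Function.iterate_succ_apply' (⇑π), Nat.succ_eq_add_one] at h2
      have h3 : ((⇑π)^[i + 1] M : ℕ) ≤ M := hM (i + 1)
      by_contra hne
      have h4 := ih (M - ((⇑π)^[i + 1] M : ℕ)) (by omega) (by omega)
      have h5 : (⇑π)^[M - ((⇑π)^[i + 1] M : ℕ)] M = (⇑π)^[i + 1] M := Fin.ext (by omega)
      have := Function.iterate_injOn_Iio_minimalPeriod (Set.mem_Iio.2 (by omega))
        (Set.mem_Iio.2 hi) h5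
      omega

theorem avoids_theta_of_le_apply_add_one (h : ∀ x : Fin n, (x : ℕ) ≤ π x + 1) :
    Avoids (theta π) p231 := by
  rw [avoids_theta_iff]
  rintro a b c hca hab ⟨M, N, i, j, hM, hN, hi, hj, rfl, rfl, h1⟩
  rintro ⟨N', K, j', k, hN', hK, hj', hk, h2, rfl, h3⟩
  obtain rfl := hN'.eq hN h2
  obtain rfl := Function.iterate_injOn_Iio_minimalPeriod (Set.mem_Iio.2 hj') (Set.mem_Iio.2 hj) h2
  have e1 := iterate_cycleMax h hM i hi
  have e2 := iterate_cycleMax h hN j' hj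
  have e3 := iterate_cycleMax h hK k hk
  have hMK : M = K := by
    have hMK : M ≤ K := by
      rcases h1 with h1 | ⟨h1, -⟩ <;> rcases h3 with h3 | ⟨h3, -⟩ <;> omega
    have e4 := iterate_cycleMax h hK (K - M) (by omega)
    exact hM.eq hK (i := 0) (j := K - M) (Fin.ext (by simp only [Function.iterate_zero_apply]; omega))
  omega

theorem avoids_and_avoids_theta_iff :
    Avoids π p231 ∧ Avoids (theta π) p231 ↔ ∀ x : Fin n, (x : ℕ) ≤ π x + 1 :=
  ⟨fun h => le_apply_add_one_of_avoids h.1 h.2,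
    fun h => ⟨avoids_of_le_apply_add_one h, avoids_theta_of_le_apply_add_one h⟩⟩

end

theorem card_perm_le_apply_add_one (n : ℕ) :
    Nat.card {π : Equiv.Perm (Fin (n + 1)) // ∀ x : Fin (n + 1), (x : ℕ) ≤ π x + 1} = 2 ^ n := by
  induction n with
  | zero =>
    rw [pow_zero, Nat.card_eq_one_iff_unique]
    exact ⟨⟨fun a b => Subtype.ext (Equiv.ext fun x => Subsingleton.elim (α := Fin 1) _ _)⟩, ⟨⟨1, by simp⟩⟩⟩
  | succ n ih =>
    let f : Bool × {π : Equiv.Perm (Fin (n + 1)) // ∀ x : Fin (n + 1), (x : ℕ) ≤ π x + 1} →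
        Equiv.Perm (Fin (n + 2)) := fun q =>
      Equiv.Perm.decomposeFin.symm (if q.1 then 0 else (q.2.1 0).succ, q.2.1)
    have hf : ∀ q, ∀ x : Fin (n + 2), (x : ℕ) ≤ f q x + 1 := by
      rintro ⟨b, e, he⟩ x
      cases b
      · induction x using Fin.cases with
        | zero => simp
        | succ x =>
          simp only [f, Equiv.Perm.decomposeFin_symm_apply_succ, Bool.false_eq_true, if_false]
          by_cases hx : x = 0
          · simp [hx]
          · rw [Equiv.swap_apply_of_ne_of_ne (Fin.succ_ne_zero _)]
            · simpa using he x
            · simpa using hx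
      · induction x using Fin.cases with
        | zero => simp
        | succ x => simpa [f] using he x
    have hbij : Function.Bijective fun q =>
        (⟨f q, hf q⟩ : {π : Equiv.Perm (Fin (n + 2)) // ∀ x : Fin (n + 2), (x : ℕ) ≤ π x + 1}) := by
      constructor
      · rintro ⟨b, e, he⟩ ⟨b', e', he'⟩ h
        have h' := Equiv.Perm.decomposeFin.symm.injective (congrArg Subtype.val h)
        simp only [Prod.mk.injEq] at h'
        obtain ⟨h1, rfl⟩ := h'
        cases b <;> cases b' <;> simp_all [Fin.succ_ne_zero, (Fin.succ_ne_zero _).symm]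
      · rintro ⟨σ, hσ⟩
        obtain ⟨⟨p, e⟩, rfl⟩ := Equiv.Perm.decomposeFin.symm.surjective σ
        have hsucc : ∀ x : Fin (n + 1), (x : ℕ) ≤ Equiv.swap 0 p (e x).succ := fun x => by
          simpa using hσ x.succ
        have he : ∀ x : Fin (n + 1), (x : ℕ) ≤ e x + 1 := by
          intro x
          have := hsucc x
          by_cases hx : (e x).succ = p
          · rw [hx, Equiv.swap_apply_right] at this
            simp at this
            simp [this]
          · rwa [Equiv.swap_apply_of_ne_of_ne (Fin.succ_ne_zero _) hx] at this
        by_cases hp : p = 0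
        · exact ⟨⟨true, e, he⟩, Subtype.ext (by simp [f, hp])⟩
        · refine ⟨⟨false, e, he⟩, Subtype.ext ?_⟩
          obtain ⟨p, rfl⟩ := Fin.exists_succ_eq_of_ne_zero hp
          have := hsucc (e.symm p)
          rw [Equiv.apply_symm_apply, Equiv.swap_apply_right] at this
          have h0 : e.symm p = 0 := Fin.ext (by simpa using this)
          have h1 : e 0 = p := by rw [← h0, Equiv.apply_symm_apply]
          simp [f, h1]
    rw [← Nat.card_congr (Equiv.ofBijective _ hbij), Nat.card_prod, ih]
    simp [pow_succ, mul_comm]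

/-- for `n ≥ 1`, `t_n(231) = 2^{n-1}`. -/
theorem t_n_231 (n : ℕ) (hn : 1 ≤ n) :
    Nat.card {π : Equiv.Perm (Fin n) // Avoids π p231 ∧ Avoids (theta π) p231} =
      2 ^ (n - 1) := by
  obtain ⟨n, rfl⟩ : ∃ m, n = m + 1 := ⟨n - 1, by omega⟩
  simp only [avoids_and_avoids_theta_iff]
  exact card_perm_le_apply_add_one n
end
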